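/- Let 𝒮 ∈ ℝ^{m×m} be symmetric with 𝒮 ⪰ 0. If for every i = 1,…,N the blocks satisfy S_i = 𝒮, 0 ≺ R_i ≺ (1/(2d_i))I, and Q_i ≺ −2d_i I, then the global LMI under Laplacian coupling holds: Q − SL − LSᵀ + LRL ≺ 0. -/

import Mathlib

open Matrix Kronecker

/-- Block-diagonal matrix built from `N` blocks of size `a × b`. -/
def blkDiag {N a b : ℕ} (M : Fin N → Matrix (Fin a) (Fin b) ℝ) :
    Matrix (Fin N × Fin a) (Fin N × Fin b) ℝ :=
  Matrix.of fun x y => if x.1 = y.1 then M x.1 x.2 y.2 else 0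

lemma sub_kronecker {l m n p : Type*} (A B : Matrix l m ℝ) (C : Matrix n p ℝ) :
    (A - B) ⊗ₖ C = A ⊗ₖ C - B ⊗ₖ C := by
  ext
  simp [sub_mul]

section BlockDiagonal

variable {N a b : ℕ}

lemma blkDiag_sub (M M' : Fin N → Matrix (Fin a) (Fin b) ℝ) :
    blkDiag (fun i => M i - M' i) = blkDiag M - blkDiag M' := by
  ext x y
  simp only [blkDiag, of_apply, Matrix.sub_apply]
  split_ifs <;> simp

lemma blkDiag_neg (M : Fin N → Matrix (Fin a) (Fin b) ℝ) :
    blkDiag (fun i => -M i) = -blkDiag M := by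
  ext x y
  simp only [blkDiag, of_apply, Matrix.neg_apply]
  split_ifs <;> simp

lemma blkDiag_smul (c : Fin N → ℝ) (M : Matrix (Fin a) (Fin b) ℝ) :
    blkDiag (fun i => c i • M) = diagonal c ⊗ₖ M := by
  ext x y
  simp only [blkDiag, of_apply, kroneckerMap_apply, diagonal_apply, Matrix.smul_apply, smul_eq_mul]
  split_ifs <;> simp

lemma blkDiag_const (M : Matrix (Fin a) (Fin b) ℝ) :
    blkDiag (fun _ : Fin N => M) = (1 : Matrix (Fin N) (Fin N) ℝ) ⊗ₖ M := by
  simpa using blkDiag_smul (fun _ : Fin N => (1 : ℝ)) M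

lemma blkDiag_isHermitian {M : Fin N → Matrix (Fin a) (Fin a) ℝ}
    (hM : ∀ i, (M i).IsHermitian) : (blkDiag M).IsHermitian := by
  refine IsHermitian.ext fun x y => ?_
  simp only [blkDiag, of_apply]
  rcases x with ⟨i, k⟩
  rcases y with ⟨j, l⟩
  by_cases h : i = j
  · subst h
    simpa using (hM i).apply k l
  · simp [h, Ne.symm h]

lemma dotProduct_blkDiag_mulVec (M : Fin N → Matrix (Fin a) (Fin a) ℝ)
    (x : Fin N × Fin a → ℝ) :
    x ⬝ᵥ (blkDiag M *ᵥ x) =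
      ∑ i, (fun k => x (i, k)) ⬝ᵥ (M i *ᵥ fun k => x (i, k)) := by
  simp [dotProduct, mulVec, blkDiag, Fintype.sum_prod_type, ite_mul, Finset.sum_ite_irrel]

lemma blkDiag_posSemidef {M : Fin N → Matrix (Fin a) (Fin a) ℝ}
    (hM : ∀ i, (M i).PosSemidef) : (blkDiag M).PosSemidef := by
  refine .of_dotProduct_mulVec_nonneg (blkDiag_isHermitian fun i => (hM i).1) fun x => ?_
  rw [star_trivial, dotProduct_blkDiag_mulVec]
  exact Finset.sum_nonneg fun i _ => by
    simpa using (hM i).dotProduct_mulVec_nonneg fun k => x (i, k)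

lemma blkDiag_posDef {M : Fin N → Matrix (Fin a) (Fin a) ℝ}
    (hM : ∀ i, (M i).PosDef) : (blkDiag M).PosDef := by
  refine .of_dotProduct_mulVec_pos (blkDiag_isHermitian fun i => (hM i).1) fun x hx => ?_
  rw [star_trivial, dotProduct_blkDiag_mulVec]
  obtain ⟨⟨i, k⟩, hik⟩ := Function.ne_iff.mp hx
  refine Finset.sum_pos' (fun j _ => ?_) ⟨i, Finset.mem_univ i, ?_⟩
  · simpa using (hM j).posSemidef.dotProduct_mulVec_nonneg fun k => x (j, k)
  · have hne : (fun k => x (i, k)) ≠ 0 := fun h => hik (congrFun h k)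
    simpa using (hM i).dotProduct_mulVec_pos hne

end BlockDiagonal

section WeightedLaplacian

variable {n : Type*} {A : Matrix n n ℝ} {d : n → ℝ}

lemma isHermitian_diagonal_sub [DecidableEq n] (hA : A.IsSymm) : (diagonal d - A).IsHermitian := by
  rw [IsHermitian, conjTranspose_eq_transpose_of_trivial, transpose_sub, diagonal_transpose, hA]

lemma laplacian_mulVec_apply [Fintype n] [DecidableEq n]
    (hd : ∀ i, d i = ∑ j, A i j) (x : n → ℝ) (i : n) :
    ((diagonal d - A) *ᵥ x) i = ∑ j, A i j * (x i - x j) := by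
  rw [sub_mulVec, Pi.sub_apply, mulVec_diagonal, hd, Finset.sum_mul]
  simp [mulVec, dotProduct, mul_sub]

lemma sum_sum_mul_sq_swap [Fintype n] (hA : A.IsSymm) (hd : ∀ i, d i = ∑ j, A i j) (x : n → ℝ) :
    ∑ i, ∑ j, A i j * x j ^ 2 = ∑ i, d i * x i ^ 2 := by
  rw [Finset.sum_comm]
  refine Finset.sum_congr rfl fun i _ => ?_
  rw [hd, Finset.sum_mul]
  exact Finset.sum_congr rfl fun j _ => by rw [hA.apply]

lemma laplacian_posSemidef [Fintype n] [DecidableEq n]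
    (hA : A.IsSymm) (hA0 : ∀ i j, 0 ≤ A i j)
    (hd : ∀ i, d i = ∑ j, A i j) : (diagonal d - A).PosSemidef := by
  refine .of_dotProduct_mulVec_nonneg (isHermitian_diagonal_sub hA) fun x => ?_
  have hswap := sum_sum_mul_sq_swap hA hd x
  have hself : ∑ i, ∑ j, A i j * x i ^ 2 = ∑ i, d i * x i ^ 2 := by
    simp_rw [hd, Finset.sum_mul]
  have hsq : 0 ≤ ∑ i, ∑ j, A i j * (x i - x j) ^ 2 :=
    Finset.sum_nonneg fun i _ => Finset.sum_nonneg fun j _ => mul_nonneg (hA0 i j) (sq_nonneg _)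
  have hform : x ⬝ᵥ ((diagonal d - A) *ᵥ x) = ∑ i, ∑ j, A i j * (x i ^ 2 - x i * x j) := by
    simp only [dotProduct, laplacian_mulVec_apply hd, Finset.mul_sum]
    exact Finset.sum_congr rfl fun i _ => Finset.sum_congr rfl fun j _ => by ring
  have hexp : ∑ i, ∑ j, A i j * (x i - x j) ^ 2 =
      2 * (∑ i, ∑ j, A i j * (x i ^ 2 - x i * x j)) - ∑ i, ∑ j, A i j * x i ^ 2
        + ∑ i, ∑ j, A i j * x j ^ 2 := by
    simp only [Finset.mul_sum, ← Finset.sum_sub_distrib, ← Finset.sum_add_distrib]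
    exact Finset.sum_congr rfl fun i _ => Finset.sum_congr rfl fun j _ => by ring
  rw [star_trivial, hform]
  linarith

lemma two_degree_sub_laplacian_sq_posSemidef [Fintype n] [DecidableEq n]
    (hA : A.IsSymm) (hA0 : ∀ i j, 0 ≤ A i j)
    (hd : ∀ i, d i = ∑ j, A i j) (hd0 : ∀ i, 0 < d i) :
    (diagonal (fun i => 2 * d i) -
      (diagonal d - A) * diagonal (fun i => 1 / (2 * d i)) * (diagonal d - A)).PosSemidef := by
  have hL : (diagonal d - A).IsHermitian := isHermitian_diagonal_sub hA
  refine .of_dotProduct_mulVec_nonneg ?_ fun x => ?_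
  · refine (isHermitian_diagonal _).sub ?_
    nth_rw 1 [← hL.eq]
    exact isHermitian_conjTranspose_mul_mul _ (isHermitian_diagonal _)
  have hform : x ⬝ᵥ ((diagonal (fun i => 2 * d i) -
      (diagonal d - A) * diagonal (fun i => 1 / (2 * d i)) * (diagonal d - A)) *ᵥ x) =
      ∑ i, 2 * d i * x i ^ 2 - ∑ i, 1 / (2 * d i) * (∑ j, A i j * (x i - x j)) ^ 2 := by
    have hLT : (diagonal d - A)ᵀ = diagonal d - A := by
      rw [← conjTranspose_eq_transpose_of_trivial, hL.eq]
    rw [sub_mulVec, dotProduct_sub, ← mulVec_mulVec, ← mulVec_mulVec, dotProduct_mulVec x,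
      dotProduct_mulVec x (diagonal d - A), ← mulVec_transpose (diagonal d - A), hLT]
    congr 1
    · simp only [dotProduct, vecMul_diagonal]
      exact Finset.sum_congr rfl fun i _ => by ring
    · simp only [dotProduct, mulVec_diagonal, laplacian_mulVec_apply hd]
      exact Finset.sum_congr rfl fun i _ => by ring
  have hterm : ∀ i, 1 / (2 * d i) * (∑ j, A i j * (x i - x j)) ^ 2 ≤
      ∑ j, (A i j * x i ^ 2 + A i j * x j ^ 2) := fun i => by
    have hcs : (∑ j, A i j * (x i - x j)) ^ 2 ≤
        (∑ j, A i j) * ∑ j, A i j * (x i - x j) ^ 2 :=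
      Finset.sum_sq_le_sum_mul_sum_of_sq_le_mul _ (fun j _ => hA0 i j)
        (fun j _ => mul_nonneg (hA0 i j) (sq_nonneg _)) fun j _ => le_of_eq (by ring)
    have hle : ∑ j, A i j * (x i - x j) ^ 2 ≤
        2 * ∑ j, (A i j * x i ^ 2 + A i j * x j ^ 2) := by
      rw [Finset.mul_sum]
      exact Finset.sum_le_sum fun j _ => by
        nlinarith [mul_nonneg (hA0 i j) (sq_nonneg (x i + x j))]
    rw [← hd] at hcs
    rw [one_div_mul_eq_div, div_le_iff₀ (by linarith [hd0 i])]
    nlinarith [mul_le_mul_of_nonneg_left hle (hd0 i).le]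
  have hsum := Finset.sum_le_sum fun i (_ : i ∈ Finset.univ) => hterm i
  simp only [Finset.sum_add_distrib] at hsum
  rw [sum_sum_mul_sq_swap hA hd x] at hsum
  simp only [← Finset.sum_mul, ← hd] at hsum
  have htwo : ∑ i, 2 * d i * x i ^ 2 = 2 * ∑ i, d i * x i ^ 2 := by
    simp only [Finset.mul_sum, mul_assoc]
  rw [star_trivial, hform]
  linarith

end WeightedLaplacian

/-- Decentralized condition (b): if `S_i = 𝒮 ⪰ 0`, `0 ≺ R_i ≺ (1/(2d_i))I` and
`Q_i ≺ −2d_iI`, then `Q − SL − LSᵀ + LRL ≺ 0` under Laplacian coupling. -/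
theorem decentralized_LMI_commonS {N m : ℕ}
    (𝒜 : Matrix (Fin N) (Fin N) ℝ)
    (h𝒜symm : 𝒜.IsSymm) (h𝒜nonneg : ∀ i j, 0 ≤ 𝒜 i j) (h𝒜diag : ∀ i, 𝒜 i i = 0)
    (d : Fin N → ℝ) (hd : ∀ i, d i = ∑ j, 𝒜 i j) (hdpos : ∀ i, 0 < d i)
    (ℒ : Matrix (Fin N) (Fin N) ℝ) (hℒ : ℒ = Matrix.diagonal d - 𝒜)
    (hconn : ∀ v : Fin N → ℝ, ℒ *ᵥ v = 0 → ∃ c : ℝ, v = fun _ => c)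
    (L : Matrix (Fin N × Fin m) (Fin N × Fin m) ℝ)
    (hL : L = ℒ ⊗ₖ (1 : Matrix (Fin m) (Fin m) ℝ))
    (Q S R : Fin N → Matrix (Fin m) (Fin m) ℝ)
    (hQsymm : ∀ i, (Q i).IsSymm) (hRsymm : ∀ i, (R i).IsSymm)
    (𝒮 : Matrix (Fin m) (Fin m) ℝ) (h𝒮symm : 𝒮.IsSymm) (h𝒮psd : 𝒮.PosSemidef)
    (hS : ∀ i, S i = 𝒮)
    (hRpos : ∀ i, (R i).PosDef)
    (hRub : ∀ i, ((1 / (2 * d i)) • (1 : Matrix (Fin m) (Fin m) ℝ) - R i).PosDef)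
    (hQub : ∀ i, (-((2 * d i) • (1 : Matrix (Fin m) (Fin m) ℝ)) - Q i).PosDef) :
    (-(blkDiag Q - blkDiag S * L - L * (blkDiag S)ᵀ + L * blkDiag R * L)).PosDef := by
  have hblkS : blkDiag S = (1 : Matrix (Fin N) (Fin N) ℝ) ⊗ₖ 𝒮 := by
    rw [← blkDiag_const, funext hS]
  have hSL : blkDiag S * L = ℒ ⊗ₖ 𝒮 := by
    rw [hblkS, hL, ← mul_kronecker_mul, one_mul, mul_one]
  have hLS : L * (blkDiag S)ᵀ = ℒ ⊗ₖ 𝒮 := by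
    rw [hblkS, hL, ← kroneckerMap_transpose, transpose_one, h𝒮symm.eq, ← mul_kronecker_mul,
      one_mul, mul_one]
  have hLpsd : ℒ.PosSemidef := hℒ ▸ laplacian_posSemidef h𝒜symm h𝒜nonneg hd
  have hLherm : Lᴴ = L := by
    rw [hL, conjTranspose_kronecker, hLpsd.1.eq, conjTranspose_one]
  have hcross := hLpsd.kronecker h𝒮psd
  have hQ := blkDiag_posDef hQub
  have hR := (blkDiag_posSemidef fun i => (hRub i).posSemidef).conjTranspose_mul_mul_same L
  have hD := (two_degree_sub_laplacian_sq_posSemidef h𝒜symm h𝒜nonneg hd hdpos).kronecker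
    (PosSemidef.one (n := Fin m) (R := ℝ))
  rw [blkDiag_sub, blkDiag_neg, blkDiag_smul] at hQ
  rw [hLherm, blkDiag_sub, blkDiag_smul] at hR
  rw [← hℒ, sub_kronecker] at hD
  have hLDL : (ℒ * diagonal (fun i => 1 / (2 * d i)) * ℒ) ⊗ₖ (1 : Matrix (Fin m) (Fin m) ℝ) =
      L * (diagonal (fun i => 1 / (2 * d i)) ⊗ₖ (1 : Matrix (Fin m) (Fin m) ℝ)) * L := by
    rw [hL, ← mul_kronecker_mul, ← mul_kronecker_mul, one_mul, one_mul]
  rw [hLDL] at hD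
  convert (((hQ.add_posSemidef hD).add_posSemidef hR).add_posSemidef hcross).add_posSemidef
    hcross using 1
  rw [hSL, hLS, mul_sub, sub_mul]
  abel
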